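/- arXiv:math/0206087 — 3 statements merged into one kernel-verified Lean document; each statement's English description precedes it below -/
import Mathlib

section
/- Let A₁,…,A_p be n×n complex matrices (p ≥ 1, n ≥ 1). The centralizer of the p-tuple (A₁,…,A_p) is trivial (i.e. the only matrices commuting with every A_j are the scalar multiples of the identity) if and only if the linear map from (sl(n,ℂ))^p to sl(n,ℂ) defined by (X₁,…,X_p) ↦ Σ_{j=1}^p [A_j, X_j] (where [A,X] = AX − XA) is surjective. -/
open Matrix Polynomial BigOperators Finset

noncomputable section

def commSubmodule (N : Type*) [Fintype N] (A : Matrix N N ℂ) :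
    Submodule ℂ (Matrix N N ℂ) where
  carrier := {X | X * A = A * X}
  add_mem' := by
    intro X Y hX hY
    simp only [Set.mem_setOf_eq] at *
    rw [Matrix.add_mul, Matrix.mul_add, hX, hY]
  zero_mem' := by
    simp only [Set.mem_setOf_eq, Matrix.zero_mul, Matrix.mul_zero]
  smul_mem' := by
    intro c X hX
    simp only [Set.mem_setOf_eq] at *
    rw [Matrix.smul_mul, Matrix.mul_smul, hX]

/-- `d` of a matrix: `n² - dim of centralizer`. -/
def dQ {N : Type*} [Fintype N] (A : Matrix N N ℂ) : ℕ :=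
  Fintype.card N ^ 2 - Module.finrank ℂ (commSubmodule N A)

/-- `r` of a matrix: the minimum over `μ` of `rank (A - μ • 1)`. -/
def rQ {N : Type*} [Fintype N] [DecidableEq N] (A : Matrix N N ℂ) : ℕ :=
  sInf {k | ∃ μ : ℂ, (A - μ • (1 : Matrix N N ℂ)).rank = k}

/-- The conjugacy class of a matrix under `GL(n, ℂ)`-conjugation. -/
def conjClass {n : ℕ} (A : Matrix (Fin n) (Fin n) ℂ) : Set (Matrix (Fin n) (Fin n) ℂ) :=
  {B | ∃ g : (Matrix (Fin n) (Fin n) ℂ)ˣ, B = (g : Matrix (Fin n) (Fin n) ℂ) * A * (↑g⁻¹ : Matrix (Fin n) (Fin n) ℂ)}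

/-- The conjugacy class of an element of `GL(n, ℂ)`. -/
def conjClassU {n : ℕ} (M : (Matrix (Fin n) (Fin n) ℂ)ˣ) : Set ((Matrix (Fin n) (Fin n) ℂ)ˣ) :=
  {N | ∃ g, N = g * M * g⁻¹}

/-- Irreducibility of a tuple: no common invariant subspace other than `⊥` and `⊤`. -/
def IrredTuple {N : Type*} [Fintype N] {q : ℕ} (A : Fin q → Matrix N N ℂ) : Prop :=
  ∀ U : Submodule ℂ (N → ℂ), (∀ j, ∀ v ∈ U, (A j).mulVec v ∈ U) → U = ⊥ ∨ U = ⊤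

/-- Trivial centralizer of a tuple: only scalar matrices commute with all members. -/
def TrivCent {N : Type*} [Fintype N] [DecidableEq N] {q : ℕ} (A : Fin q → Matrix N N ℂ) : Prop :=
  ∀ X : Matrix N N ℂ, (∀ j, X * A j = A j * X) → ∃ κ : ℂ, X = κ • (1 : Matrix N N ℂ)

/-- A matrix has `n` distinct eigenvalues. -/
def HasDistinctEigen {n : ℕ} (A : Matrix (Fin n) (Fin n) ℂ) : Prop :=
  ∃ ev : Fin n → ℂ, Function.Injective ev ∧
    A.charpoly = ∏ i, (Polynomial.X - Polynomial.C (ev i))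

/-- The variety 𝒱(c₁,…,c_{q}) where `c_j` is the conjugacy class of `A j`. -/
def Vset {n q : ℕ} (A : Fin q → Matrix (Fin n) (Fin n) ℂ) :
    Set (Fin q → Matrix (Fin n) (Fin n) ℂ) :=
  {B | (∀ j, B j ∈ conjClass (A j)) ∧ ∑ j, B j = 0}

/-- The variety 𝒲(C₁,…,C_q) where `C_j` is the conjugacy class of `M j` in `GL(n,ℂ)`. -/
def Wset {n q : ℕ} (M : Fin q → (Matrix (Fin n) (Fin n) ℂ)ˣ) :
    Set (Fin q → (Matrix (Fin n) (Fin n) ℂ)ˣ) :=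
  {B | (∀ j, B j ∈ conjClassU (M j)) ∧ (List.ofFn B).prod = 1}


/-- Every linear functional on square matrices is of the form `Z ↦ tr (B * Z)`. -/
theorem exists_trace_mul_eq {N : Type*} [Fintype N] [DecidableEq N] (f : Matrix N N ℂ →ₗ[ℂ] ℂ) :
    ∃ B : Matrix N N ℂ, ∀ Z, (B * Z).trace = f Z := by
  refine ⟨Matrix.of fun i j => f (Matrix.single j i 1), fun Z => ?_⟩
  conv_rhs => rw [Matrix.matrix_eq_sum_single Z]
  simp only [map_sum, Matrix.trace, Matrix.diag_apply, Matrix.mul_apply, Matrix.of_apply]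
  rw [Finset.sum_comm]
  refine Finset.sum_congr rfl fun i _ => Finset.sum_congr rfl fun j _ => ?_
  rw [show Matrix.single i j (Z i j) = Z i j • Matrix.single i j (1 : ℂ) by simp, map_smul,
    smul_eq_mul, mul_comm]

theorem trace_mul_commutator {N : Type*} [Fintype N] (B A X : Matrix N N ℂ) :
    (B * (A * X - X * A)).trace = ((B * A - A * B) * X).trace := by
  rw [Matrix.mul_sub, Matrix.sub_mul, Matrix.trace_sub, Matrix.trace_sub, Matrix.mul_assoc,
    ← Matrix.mul_assoc B X A, Matrix.trace_mul_comm (B * X) A, ← Matrix.mul_assoc A B X,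
    Matrix.mul_assoc A B X]

/-- The traceless part of a square matrix is traceless. -/
theorem trace_sub_trace_div_smul_one {n : ℕ} (hn : 1 ≤ n) (W : Matrix (Fin n) (Fin n) ℂ) :
    (W - (W.trace / n) • (1 : Matrix (Fin n) (Fin n) ℂ)).trace = 0 := by
  have hn0 : (n : ℂ) ≠ 0 := Nat.cast_ne_zero.mpr (by lia)
  simp [Matrix.trace_sub, Matrix.trace_smul, hn0]

/-- The map `(X₁,…,X_p) ↦ Σ [A_j, X_j]` on tuples of matrices. -/
def commutatorSum {N : Type*} [Fintype N] {p : ℕ} (A : Fin p → Matrix N N ℂ) :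
    (Fin p → Matrix N N ℂ) →ₗ[ℂ] Matrix N N ℂ where
  toFun X := ∑ j, (A j * X j - X j * A j)
  map_add' X Y := by
    rw [← Finset.sum_add_distrib]
    refine Finset.sum_congr rfl fun j _ => ?_
    simp only [Pi.add_apply, Matrix.mul_add, Matrix.add_mul]
    abel
  map_smul' c X := by
    simp [Finset.smul_sum, smul_sub]

/-- A traceless matrix lies in the range of `commutatorSum A` if the centralizer is trivial. -/
theorem TrivCent.mem_range_commutatorSum {N : Type*} [Fintype N] [DecidableEq N] {p : ℕ}
    {A : Fin p → Matrix N N ℂ} (h : TrivCent A) {Y : Matrix N N ℂ} (hY : Y.trace = 0) :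
    Y ∈ LinearMap.range (commutatorSum A) := by
  by_contra hmem
  obtain ⟨f, hf, hle⟩ := Submodule.exists_le_ker_of_notMem hmem
  obtain ⟨B, hB⟩ := exists_trace_mul_eq f
  have hcomm : ∀ j, B * A j = A j * B := by
    intro j
    rw [← sub_eq_zero]
    refine Matrix.ext_iff_trace_mul_right.mpr fun X => ?_
    have hX : f (commutatorSum A (Pi.single j X)) = 0 := hle ⟨_, rfl⟩
    have hs : commutatorSum A (Pi.single j X) = A j * X - X * A j := by
      change ∑ i, (A i * (Pi.single j X : Fin p → Matrix N N ℂ) i -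
        (Pi.single j X : Fin p → Matrix N N ℂ) i * A i) = _
      rw [Finset.sum_eq_single j]
      · simp
      · intro i _ hi
        simp [Pi.single_eq_of_ne hi]
      · simp
    rw [hs, ← hB, trace_mul_commutator] at hX
    simpa using hX
  obtain ⟨κ, rfl⟩ := h B hcomm
  apply hf
  rw [← hB]
  simp [hY]

/-- the centralizer of `(A₁,…,A_p)` is trivial iff
`(X₁,…,X_p) ↦ Σ [A_j, X_j]`, as a map `(sl(n,ℂ))^p → sl(n,ℂ)`, is surjective. -/
theorem stmt11 (p n : ℕ) (hp : 1 ≤ p) (hn : 1 ≤ n)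
    (A : Fin p → Matrix (Fin n) (Fin n) ℂ) :
    TrivCent A ↔
      ∀ Y : Matrix (Fin n) (Fin n) ℂ, Y.trace = 0 →
        ∃ X : Fin p → Matrix (Fin n) (Fin n) ℂ,
          (∀ j, (X j).trace = 0) ∧ ∑ j, (A j * X j - X j * A j) = Y := by
  constructor
  · intro h Y hY
    obtain ⟨X, hX⟩ := h.mem_range_commutatorSum hY
    refine ⟨fun j => X j - ((X j).trace / n) • 1,
      fun j => trace_sub_trace_div_smul_one hn (X j), ?_⟩
    rw [← hX]
    refine Finset.sum_congr rfl fun j _ => ?_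
    simp [Matrix.mul_sub, Matrix.sub_mul]
  · intro h B hB
    refine ⟨B.trace / n, Matrix.ext_iff_trace_mul_right.mpr fun W => ?_⟩
    obtain ⟨X, -, hX⟩ := h _ (trace_sub_trace_div_smul_one hn W)
    have h0 : (B * (W - (W.trace / n) • 1)).trace = 0 := by
      rw [← hX, Matrix.mul_sum, Matrix.trace_sum]
      refine Finset.sum_eq_zero fun j _ => ?_
      rw [trace_mul_commutator, hB j, sub_self, Matrix.zero_mul, Matrix.trace_zero]
    rw [Matrix.mul_sub, Matrix.trace_sub, sub_eq_zero] at h0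
    rw [h0]
    simp only [Matrix.mul_smul, Matrix.mul_one, Matrix.smul_mul, Matrix.one_mul,
      Matrix.trace_smul, smul_eq_mul]
    ring
end
end

section
/- Let A be an n×n complex matrix and let B be a diagonalizable n×n complex matrix such that the multiset of multiplicities of the distinct eigenvalues of B equals the multiset of the positive integers rank((A−λI)^{k−1}) − rank((A−λI)^k), taken over all eigenvalues λ of A and all integers k ≥ 1 for which this difference is positive (so that the Jordan normal form of B is the diagonal Jordan normal form corresponding to the Jordan normal form of A). Then the quantities d and r agree for A and B: dim_ℂ{X : XA = AX} = dim_ℂ{X : XB = BX}, and min_{μ∈ℂ} rank(A − μI) = min_{μ∈ℂ} rank(B − μI). -/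
open Matrix Polynomial BigOperators Finset

noncomputable section

/-- Homomorphisms out of a cyclic module `R ⧸ (a)` are the elements killed by `a`. -/
def homQuotientEquivTorsionBy {K R M : Type*} [Field K] [CommRing R] [Algebra K R]
    [AddCommGroup M] [Module R M] [Module K M] [IsScalarTower K R M] (a : R) :
    ((R ⧸ Ideal.span {a}) →ₗ[R] M) ≃ₗ[K] (Submodule.torsionBy R M a).restrictScalars K where
  toFun f := ⟨f 1, by
    have h : (a • (1 : R ⧸ Ideal.span {a})) = 0 := by
      rw [← map_one (Ideal.Quotient.mk (Ideal.span {a})), ← Ideal.Quotient.mk_eq_mk,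
        ← Submodule.Quotient.mk_smul, Submodule.Quotient.mk_eq_zero]
      simp
    simp [← map_smul, h]⟩
  invFun v := Submodule.liftQ _ (LinearMap.toSpanSingleton R M v.1) (by
    have hv : a • v.1 = 0 := v.2
    rw [Ideal.span, Submodule.span_le]
    simp [hv])
  map_add' f g := rfl
  map_smul' c f := rfl
  left_inv f := by
    refine Submodule.linearMap_qext _ (LinearMap.ext_ring ?_)
    simp
  right_inv v := by
    ext
    change (Submodule.liftQ _ (LinearMap.toSpanSingleton R M v.1) _)
      (Submodule.Quotient.mk (1 : R)) = _
    rw [Submodule.liftQ_apply]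
    simp

lemma finrank_torsionBy_congr {K R M N : Type*} [Field K] [CommRing R] [Algebra K R]
    [AddCommGroup M] [Module R M] [Module K M] [IsScalarTower K R M]
    [AddCommGroup N] [Module R N] [Module K N] [IsScalarTower K R N] (e : M ≃ₗ[R] N) (a : R) :
    Module.finrank K ((Submodule.torsionBy R M a).restrictScalars K) =
      Module.finrank K ((Submodule.torsionBy R N a).restrictScalars K) := by
  refine LinearEquiv.finrank_eq ((e.restrictScalars K).ofSubmodules _ _ ?_)
  ext x
  simp only [Submodule.mem_map, Submodule.restrictScalars_mem, Submodule.mem_torsionBy_iff]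
  constructor
  · rintro ⟨y, hy, rfl⟩
    have : a • e y = 0 := by rw [← map_smul, hy, map_zero]
    exact this
  · intro hx
    exact ⟨e.symm x, by rw [← map_smul, hx, map_zero], e.apply_symm_apply x⟩

lemma finrank_torsionBy_pi {K R ι : Type*} [Field K] [CommRing R] [Algebra K R] [Fintype ι]
    {M : ι → Type*} [∀ i, AddCommGroup (M i)] [∀ i, Module R (M i)] [∀ i, Module K (M i)]
    [∀ i, IsScalarTower K R (M i)] [∀ i, FiniteDimensional K (M i)] (a : R) :
    Module.finrank K ((Submodule.torsionBy R (∀ i, M i) a).restrictScalars K) =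
      ∑ i, Module.finrank K ((Submodule.torsionBy R (M i) a).restrictScalars K) := by
  rw [← Module.finrank_pi_fintype K]
  refine LinearEquiv.finrank_eq
    { toFun := fun v i => ⟨v.1 i, congrFun (show a • v.1 = 0 from v.2) i⟩
      invFun := fun w => ⟨fun i => (w i).1, funext fun i => (w i).2⟩
      map_add' := fun _ _ => rfl
      map_smul' := fun _ _ => rfl
      left_inv := fun _ => rfl
      right_inv := fun _ => rfl }

lemma finrank_torsionBy_quotient_X_sub_C_pow {K : Type*} [Field K] [DecidableEq K] (μ ν : K) (k m : ℕ) :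
    Module.finrank K ((Submodule.torsionBy K[X]
      (K[X] ⧸ Ideal.span {(X - C ν : K[X]) ^ m}) ((X - C μ) ^ k)).restrictScalars K) =
      if ν = μ then min k m else 0 := by
  set q : K[X] := (X - C ν) ^ m with hq
  set a : K[X] := (X - C μ) ^ k with ha
  have hq0 : q.Monic := (monic_X_sub_C ν).pow m
  have hfin : FiniteDimensional K (K[X] ⧸ Ideal.span {q}) := hq0.finite_quotient
  let f : (K[X] ⧸ Ideal.span {q}) →ₗ[K] (K[X] ⧸ Ideal.span {q}) :=
    (Algebra.lsmul K K _ a)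
  have hker : (Submodule.torsionBy K[X] (K[X] ⧸ Ideal.span {q}) a).restrictScalars K =
      LinearMap.ker f := rfl
  have h1 := f.finrank_range_add_finrank_ker
  have h2 := (LinearMap.range f).finrank_quotient_add_finrank
  have hcoker : Module.finrank K ((K[X] ⧸ Ideal.span {q}) ⧸ LinearMap.range f) =
      Module.finrank K (K[X] ⧸ (Ideal.span {q} ⊔ Ideal.span {a})) := by
    rw [← (DoubleQuot.quotQuotEquivQuotSupₐ K (Ideal.span {q})
      (Ideal.span {a})).toLinearEquiv.finrank_eq]
    have : LinearMap.range f = ((Ideal.span {a}).map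
        (Ideal.Quotient.mkₐ K (Ideal.span {q}))).restrictScalars K := by
      rw [Ideal.map_span, Set.image_singleton]
      ext x
      rw [Submodule.restrictScalars_mem, Ideal.mem_span_singleton']
      constructor
      · rintro ⟨y, rfl⟩
        refine ⟨y, ?_⟩
        rw [mul_comm]
        exact (Algebra.smul_def a y).symm
      · rintro ⟨y, rfl⟩
        refine ⟨y, ?_⟩
        rw [mul_comm]
        exact (Algebra.smul_def a y)
    rw [this]
    rfl
  have hsup : Module.finrank K (K[X] ⧸ (Ideal.span {q} ⊔ Ideal.span {a})) =
      if ν = μ then min k m else 0 := by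
    split_ifs with h
    · subst h
      have : Ideal.span {q} ⊔ Ideal.span {a} = Ideal.span {(X - C ν) ^ min k m} := by
        rcases le_total k m with hkm | hkm
        · rw [min_eq_left hkm, sup_eq_right, Ideal.span_singleton_le_span_singleton]
          exact pow_dvd_pow _ hkm
        · rw [min_eq_right hkm, sup_eq_left, Ideal.span_singleton_le_span_singleton]
          exact pow_dvd_pow _ hkm
      rw [this, finrank_quotient_span_eq_natDegree, natDegree_pow, natDegree_X_sub_C, mul_one]
    · have hc : IsCoprime q a := (pairwise_coprime_X_sub_C Function.injective_id h).pow
      rw [← Ideal.isCoprime_span_singleton_iff, Ideal.isCoprime_iff_sup_eq] at hc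
      rw [hc, Module.finrank_eq_zero_iff_of_free]
      exact Ideal.Quotient.subsingleton_iff.2 rfl
  rw [hker]
  omega

lemma exists_equiv_pi_quotient_X_sub_C_pow {M : Type*} [AddCommGroup M] [Module ℂ[X] M]
    [Module.Finite ℂ[X] M] (hM : Module.IsTorsion ℂ[X] M) :
    ∃ (ι : Type) (_ : Fintype ι) (ev : ι → ℂ) (e : ι → ℕ),
      Nonempty (M ≃ₗ[ℂ[X]] ∀ i, ℂ[X] ⧸ Ideal.span {(X - C (ev i) : ℂ[X]) ^ e i}) := by
  classical
  obtain ⟨ι, _, p, hp, e, ⟨l⟩⟩ := Module.equiv_directSum_of_isTorsion hM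
  have hroot : ∀ i, ∃ z, (p i).IsRoot z := fun i =>
    IsAlgClosed.exists_root _ (degree_pos_of_irreducible (hp i)).ne'
  choose ev hev using hroot
  have hspan : ∀ i, Ideal.span {p i ^ e i} = Ideal.span {(X - C (ev i) : ℂ[X]) ^ e i} := fun i =>
    Ideal.span_singleton_eq_span_singleton.2 (((irreducible_X_sub_C _).associated_of_dvd (hp i)
      (dvd_iff_isRoot.2 (hev i))).symm.pow_pow)
  exact ⟨ι, inferInstance, ev, e, ⟨l ≪≫ₗ DirectSum.linearEquivFunOnFintype _ _ _ ≪≫ₗ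
    LinearEquiv.piCongrRight fun i => Submodule.quotEquivOfEq _ _ (hspan i)⟩⟩

lemma finrank_torsionBy_AEval {N : Type*} [Fintype N] [DecidableEq N] (A : Matrix N N ℂ)
    (μ : ℂ) (k : ℕ) :
    Module.finrank ℂ ((Submodule.torsionBy ℂ[X] (Module.AEval' (Matrix.toLin' A))
      ((X - C μ) ^ k)).restrictScalars ℂ) + ((A - μ • (1 : Matrix N N ℂ)) ^ k).rank =
      Fintype.card N := by
  have h : aeval (Matrix.toLin' A) ((X - C μ) ^ k) =
      Matrix.toLin' ((A - μ • (1 : Matrix N N ℂ)) ^ k) := by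
    rw [Matrix.toLin'_pow]
    simp [Algebra.algebraMap_eq_smul_one, Module.End.one_eq_id]
  have e := (LinearMap.ker (aeval (Matrix.toLin' A) ((X - C μ) ^ k))).equivMapOfInjective
      (Module.AEval'.of (Matrix.toLin' A)).toLinearMap (LinearEquiv.injective _)
  have hm : (LinearMap.ker (aeval (Matrix.toLin' A) ((X - C μ) ^ k))).map
      (Module.AEval'.of (Matrix.toLin' A)).toLinearMap =
      (Submodule.torsionBy ℂ[X] (Module.AEval' (Matrix.toLin' A))
        ((X - C μ) ^ k)).restrictScalars ℂ := by
    ext x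
    obtain ⟨y, rfl⟩ := (Module.AEval'.of (Matrix.toLin' A)).surjective x
    rw [Submodule.restrictScalars_mem, Submodule.mem_torsionBy_iff, ← Module.AEval.of_aeval_smul]
    simp
  rw [← hm, ← e.finrank_eq, h, add_comm]
  have := (Matrix.toLin' ((A - μ • (1 : Matrix N N ℂ)) ^ k)).finrank_range_add_finrank_ker
  rw [Module.finrank_fintype_fun_eq_card] at this
  exact this

lemma finrank_commSubmodule_eq_finrank_end_AEval {N : Type*} [Fintype N] [DecidableEq N]
    (A : Matrix N N ℂ) :
    Module.finrank ℂ (commSubmodule N A) = Module.finrank ℂ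
      (Module.AEval' (Matrix.toLin' A) →ₗ[ℂ[X]] Module.AEval' (Matrix.toLin' A)) := by
  let φ := Matrix.toLin' A
  let o := Module.AEval'.of φ
  have ho : ∀ v, o (φ v) = (X : ℂ[X]) • o v := fun v => (Module.AEval'.X_smul_of φ v).symm
  refine LinearEquiv.finrank_eq
    { toFun := fun Y => LinearMap.ofAEval φ (o.toLinearMap ∘ₗ Matrix.toLin' Y.1) fun v => ?_
      invFun := fun f => ⟨LinearMap.toMatrix' (o.symm.toLinearMap ∘ₗ f.restrictScalars ℂ ∘ₗ
        o.toLinearMap), ?_⟩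
      map_add' := fun Y Z => ?_
      map_smul' := fun c Y => ?_
      left_inv := fun Y => ?_
      right_inv := fun f => ?_ }
  · have hY : Y.1 * A = A * Y.1 := Y.2
    change o (Matrix.toLin' Y.1 (φ v)) = (X : ℂ[X]) • o (Matrix.toLin' Y.1 v)
    rw [← ho, ← Matrix.toLin'_mul_apply, hY, Matrix.toLin'_mul_apply]
  · ext v
    change o (Matrix.toLin' (Y.1 + Z.1) _) = o (Matrix.toLin' Y.1 _) + o (Matrix.toLin' Z.1 _)
    rw [map_add, LinearMap.add_apply, map_add]
  · ext v
    change o (Matrix.toLin' (c • Y.1) _) = c • o (Matrix.toLin' Y.1 _)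
    rw [map_smul, LinearMap.smul_apply, map_smul]
  · change _ * A = A * _
    apply Matrix.toLin'.injective
    rw [Matrix.toLin'_mul, Matrix.toLin'_mul, Matrix.toLin'_toMatrix']
    refine LinearMap.ext fun v => o.injective ?_
    change o (o.symm (f (o (φ v)))) = o (φ (o.symm (f (o v))))
    rw [ho, ho, map_smul, LinearEquiv.apply_symm_apply, LinearEquiv.apply_symm_apply]
  · apply Subtype.ext
    apply Matrix.toLin'.injective
    change Matrix.toLin' (LinearMap.toMatrix' _) = _
    rw [Matrix.toLin'_toMatrix']
    refine LinearMap.ext fun v => ?_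
    change o.symm (o (Matrix.toLin' Y.1 (o.symm (o v)))) = _
    rw [LinearEquiv.symm_apply_apply, LinearEquiv.symm_apply_apply]
  · refine LinearMap.ext fun v => ?_
    change o (Matrix.toLin' (LinearMap.toMatrix' _) (o.symm v)) = f v
    rw [Matrix.toLin'_toMatrix']
    change o (o.symm (f (o (o.symm v)))) = f v
    rw [LinearEquiv.apply_symm_apply, LinearEquiv.apply_symm_apply]

lemma finrank_end_eq_sum_finrank_torsionBy {K R M ι : Type*} [Field K] [CommRing R] [Algebra K R]
    [AddCommGroup M] [Module R M] [Module K M] [IsScalarTower K R M] [FiniteDimensional K M]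
    [Fintype ι] (a : ι → R) (l : M ≃ₗ[R] ∀ i, R ⧸ Ideal.span {a i}) :
    Module.finrank K (M →ₗ[R] M) =
      ∑ i, Module.finrank K ((Submodule.torsionBy R M (a i)).restrictScalars K) := by
  classical
  have hom : (M →ₗ[R] M) ≃ₗ[K] ∀ i, (Submodule.torsionBy R M (a i)).restrictScalars K :=
    LinearEquiv.congrLeft _ K l ≪≫ₗ (LinearMap.lsum R _ K).symm ≪≫ₗ
      LinearEquiv.piCongrRight fun i => homQuotientEquivTorsionBy _
  rw [hom.finrank_eq, Module.finrank_pi_fintype]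

/-- The Jordan blocks of `A`, given by eigenvalues `ev i` and sizes `e i`, together with the
ranks and the centralizer dimension they determine. -/
lemma exists_jordan_block_sizes {N : Type*} [Fintype N] [DecidableEq N] (A : Matrix N N ℂ) :
    ∃ (ι : Type) (_ : Fintype ι) (ev : ι → ℂ) (e : ι → ℕ),
      (∀ (μ : ℂ) (k : ℕ), (∑ i, if ev i = μ then min k (e i) else 0) +
        ((A - μ • (1 : Matrix N N ℂ)) ^ k).rank = Fintype.card N) ∧
      Module.finrank ℂ (commSubmodule N A) =
        ∑ i, ∑ j, if ev j = ev i then min (e i) (e j) else 0 := by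
  obtain ⟨ι, _, ev, e, ⟨l⟩⟩ := exists_equiv_pi_quotient_X_sub_C_pow
    (M := Module.AEval' (Matrix.toLin' A)) (Module.AEval.isTorsion_of_finiteDimensional ..)
  have hfin : ∀ i, FiniteDimensional ℂ (ℂ[X] ⧸ Ideal.span {(X - C (ev i) : ℂ[X]) ^ e i}) :=
    fun i => ((monic_X_sub_C (ev i)).pow (e i)).finite_quotient
  have htors : ∀ (μ : ℂ) (k : ℕ),
      Module.finrank ℂ ((Submodule.torsionBy ℂ[X] (Module.AEval' (Matrix.toLin' A))
        ((X - C μ) ^ k)).restrictScalars ℂ) = ∑ i, if ev i = μ then min k (e i) else 0 := by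
    intro μ k
    rw [finrank_torsionBy_congr l, finrank_torsionBy_pi]
    exact Finset.sum_congr rfl fun i _ => finrank_torsionBy_quotient_X_sub_C_pow μ (ev i) k (e i)
  refine ⟨ι, inferInstance, ev, e, fun μ k => ?_, ?_⟩
  · rw [← htors, finrank_torsionBy_AEval]
  · rw [finrank_commSubmodule_eq_finrank_end_AEval, finrank_end_eq_sum_finrank_torsionBy _ l]
    exact Finset.sum_congr rfl fun i _ => htors (ev i) (e i)

lemma mem_roots_charpoly_of_rank_lt {K N : Type*} [Field K] [DecidableEq K] [Fintype N]
    [DecidableEq N] {A : Matrix N N K} {μ : K}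
    (h : (A - μ • (1 : Matrix N N K)).rank < Fintype.card N) :
    μ ∈ A.charpoly.roots.toFinset := by
  rw [Multiset.mem_toFinset, mem_roots A.charpoly_monic.ne_zero, IsRoot.def, Matrix.eval_charpoly]
  by_contra hdet
  rw [← neg_sub, Matrix.det_neg, Matrix.scalar_apply, ← Matrix.smul_one_eq_diagonal] at hdet
  exact h.ne (Matrix.rank_of_isUnit _ ((Matrix.isUnit_iff_isUnit_det _).2
    (right_ne_zero_of_mul hdet).isUnit))

section BlockSizes

variable {N ι : Type*} [Fintype N] [DecidableEq N] [Fintype ι] {A : Matrix N N ℂ}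
  {ev : ι → ℂ} {e : ι → ℕ}

lemma rank_pow_pred_sub_rank_pow
    (h : ∀ (μ : ℂ) (k : ℕ), (∑ i, if ev i = μ then min k (e i) else 0) +
        ((A - μ • (1 : Matrix N N ℂ)) ^ k).rank = Fintype.card N)
    (μ : ℂ) {k : ℕ} (hk : 1 ≤ k) :
    ((A - μ • (1 : Matrix N N ℂ)) ^ (k - 1)).rank - ((A - μ • (1 : Matrix N N ℂ)) ^ k).rank =
      #{i | ev i = μ ∧ k ≤ e i} := by
  have h1 := h μ (k - 1)
  have h2 := h μ k
  have h3 : (∑ i, if ev i = μ then min k (e i) else 0) =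
      (∑ i, if ev i = μ then min (k - 1) (e i) else 0) + #{i | ev i = μ ∧ k ≤ e i} := by
    rw [Finset.card_filter, ← Finset.sum_add_distrib]
    refine Finset.sum_congr rfl fun i _ => ?_
    split_ifs <;> grind
  omega

lemma mem_roots_charpoly_of_block
    (h : ∀ (μ : ℂ) (k : ℕ), (∑ i, if ev i = μ then min k (e i) else 0) +
        ((A - μ • (1 : Matrix N N ℂ)) ^ k).rank = Fintype.card N)
    {i : ι} (hi : 1 ≤ e i) : ev i ∈ A.charpoly.roots.toFinset := by
  apply mem_roots_charpoly_of_rank_lt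
  have h1 := h (ev i) 1
  rw [pow_one] at h1
  have h2 := Finset.single_le_sum (f := fun j => if ev j = ev i then min 1 (e j) else 0)
    (fun _ _ => Nat.zero_le _) (Finset.mem_univ i)
  simp only [if_true, min_eq_left hi] at h2
  omega

lemma block_size_le_card
    (h : ∀ (μ : ℂ) (k : ℕ), (∑ i, if ev i = μ then min k (e i) else 0) +
        ((A - μ • (1 : Matrix N N ℂ)) ^ k).rank = Fintype.card N)
    (i : ι) : e i ≤ Fintype.card N := by
  have h1 := h (ev i) (e i)
  have h2 := Finset.single_le_sum (f := fun j => if ev j = ev i then min (e i) (e j) else 0)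
    (fun _ _ => Nat.zero_le _) (Finset.mem_univ i)
  simp only [if_true, min_self] at h2
  omega

end BlockSizes

lemma finrank_commSubmodule_eq_sum_sq {N : Type*} [Fintype N] [DecidableEq N]
    (A : Matrix N N ℂ) :
    Module.finrank ℂ (commSubmodule N A) =
      ∑ q ∈ A.charpoly.roots.toFinset ×ˢ Finset.Icc 1 (Fintype.card N),
        (((A - q.1 • (1 : Matrix N N ℂ)) ^ (q.2 - 1)).rank -
          ((A - q.1 • (1 : Matrix N N ℂ)) ^ q.2).rank) ^ 2 := by
  obtain ⟨ι, _, ev, e, h, hd⟩ := exists_jordan_block_sizes A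
  have hsq : ∀ q ∈ A.charpoly.roots.toFinset ×ˢ Finset.Icc 1 (Fintype.card N),
      (((A - q.1 • (1 : Matrix N N ℂ)) ^ (q.2 - 1)).rank -
          ((A - q.1 • (1 : Matrix N N ℂ)) ^ q.2).rank) ^ 2 =
      ∑ i, ∑ j, if ev i = q.1 then
        if ev j = ev i ∧ q.2 ≤ min (e i) (e j) then 1 else 0 else 0 := by
    intro q hq
    rw [Finset.mem_product, Finset.mem_Icc] at hq
    rw [rank_pow_pred_sub_rank_pow h q.1 hq.2.1, sq, Finset.card_filter, Finset.sum_mul_sum]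
    refine Finset.sum_congr rfl fun i _ => Finset.sum_congr rfl fun j _ => ?_
    split_ifs <;> grind
  rw [hd, Finset.sum_congr rfl hsq]
  symm
  rw [Finset.sum_comm]
  refine Finset.sum_congr rfl fun i _ => ?_
  rw [Finset.sum_comm]
  refine Finset.sum_congr rfl fun j _ => ?_
  rw [Finset.sum_product_right]
  simp only [Finset.sum_ite_eq]
  rcases Nat.eq_zero_or_pos (e i) with hi | hi
  · simp only [hi, Nat.zero_min, ite_self, Nat.le_zero]
    refine Finset.sum_eq_zero fun k hk => ?_
    rw [Finset.mem_Icc] at hk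
    grind
  · simp only [if_pos (mem_roots_charpoly_of_block h hi)]
    have hle := block_size_le_card h i
    rw [← Finset.card_filter (fun k => ev j = ev i ∧ k ≤ min (e i) (e j))]
    split_ifs with hij
    · have : ({k ∈ Finset.Icc 1 (Fintype.card N) | ev j = ev i ∧ k ≤ min (e i) (e j)}) =
          Finset.Icc 1 (min (e i) (e j)) := by
        ext k
        simp only [Finset.mem_filter, Finset.mem_Icc]
        grind
      rw [this, Nat.card_Icc, Nat.add_sub_cancel]
    · simp [hij]

lemma finrank_commSubmodule_conj {N : Type*} [Fintype N] [DecidableEq N] (A : Matrix N N ℂ)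
    (P : (Matrix N N ℂ)ˣ) :
    Module.finrank ℂ (commSubmodule N (P.1 * A * P⁻¹.1)) =
      Module.finrank ℂ (commSubmodule N A) := by
  let c := (MulSemiringAction.toAlgEquiv ℂ (Matrix N N ℂ) (ConjAct.toConjAct P))
  have hc : ∀ Y, c Y = P.1 * Y * P⁻¹.1 := fun Y => rfl
  symm
  refine LinearEquiv.finrank_eq (c.toLinearEquiv.ofSubmodules _ _ ?_)
  ext Y
  obtain ⟨Z, rfl⟩ := c.surjective Y
  rw [← hc, Submodule.mem_map]
  change (∃ y, y * A = A * y ∧ c y = c Z) ↔ c Z * c A = c A * c Z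
  simp [← map_mul]

lemma finrank_commSubmodule_diagonal {N : Type*} [Fintype N] [DecidableEq N] (D : N → ℂ) :
    Module.finrank ℂ (commSubmodule N (Matrix.diagonal D)) =
      ∑ μ ∈ Finset.univ.image D, #{i | D i = μ} ^ 2 := by
  have hmem : ∀ Y, Y ∈ commSubmodule N (Matrix.diagonal D) ↔ ∀ i j, D i ≠ D j → Y i j = 0 := by
    intro Y
    change Y * Matrix.diagonal D = Matrix.diagonal D * Y ↔ _
    rw [← Matrix.ext_iff]
    refine forall₂_congr fun i j => ?_
    rw [Matrix.mul_diagonal, Matrix.diagonal_mul, mul_comm, mul_eq_mul_right_iff]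
    grind
  have e : commSubmodule N (Matrix.diagonal D) ≃ₗ[ℂ] ({p : N × N // D p.1 = D p.2} → ℂ) :=
    { toFun := fun Y p => Y.1 p.1.1 p.1.2
      invFun := fun f => ⟨fun i j => if h : D i = D j then f ⟨(i, j), h⟩ else 0,
        (hmem _).2 fun i j h => dif_neg h⟩
      map_add' := fun _ _ => rfl
      map_smul' := fun _ _ => rfl
      left_inv := fun Y => by
        ext i j
        by_cases h : D i = D j
        · simp [h]
        · simp [h, (hmem _).1 Y.2 i j h]
      right_inv := fun f => by
        ext p
        simp [p.2] }
  rw [e.finrank_eq, Module.finrank_fintype_fun_eq_card, Fintype.card_subtype,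
    Finset.card_eq_sum_card_fiberwise (f := fun p => D p.1) (t := Finset.univ.image D)
      (fun p _ => by simp)]
  refine Finset.sum_congr rfl fun μ _ => ?_
  rw [sq, ← Finset.card_product]
  congr 1
  ext p
  simp only [Finset.mem_filter, Finset.mem_univ, true_and, Finset.mem_product]
  grind

lemma rank_conj_diagonal_sub_smul_one {N : Type*} [Fintype N] [DecidableEq N]
    (P : (Matrix N N ℂ)ˣ) (D : N → ℂ) (μ : ℂ) :
    (P.1 * Matrix.diagonal D * P⁻¹.1 - μ • (1 : Matrix N N ℂ)).rank + #{i | D i = μ} =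
      Fintype.card N := by
  have h : P.1 * Matrix.diagonal D * P⁻¹.1 - μ • (1 : Matrix N N ℂ) =
      P.1 * Matrix.diagonal (fun i => D i - μ) * P⁻¹.1 := by
    have : Matrix.diagonal (fun i => D i - μ) = Matrix.diagonal D - μ • (1 : Matrix N N ℂ) := by
      rw [Matrix.smul_one_eq_diagonal, Matrix.diagonal_sub]
    rw [this, mul_sub, sub_mul, mul_smul_comm, smul_mul_assoc, mul_one, Units.mul_inv]
  rw [h, Matrix.rank_mul_eq_left_of_isUnit_det _ _
      ((Matrix.isUnit_iff_isUnit_det _).1 P⁻¹.isUnit),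
    Matrix.rank_mul_eq_right_of_isUnit_det _ _
      ((Matrix.isUnit_iff_isUnit_det _).1 P.isUnit), Matrix.rank_diagonal, Fintype.card_subtype,
    add_comm]
  simp only [ne_eq, sub_eq_zero]
  exact Finset.card_filter_add_card_filter_not _

lemma rQ_le_of_forall_exists {N : Type*} [Fintype N] [DecidableEq N] {A B : Matrix N N ℂ}
    (h : ∀ μ : ℂ, ∃ ν : ℂ, (A - ν • (1 : Matrix N N ℂ)).rank ≤
      (B - μ • (1 : Matrix N N ℂ)).rank) : rQ A ≤ rQ B := by
  have hne : {k | ∃ μ : ℂ, (B - μ • (1 : Matrix N N ℂ)).rank = k}.Nonempty := ⟨_, 0, rfl⟩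
  obtain ⟨μ, hμ⟩ := Nat.sInf_mem hne
  obtain ⟨ν, hν⟩ := h μ
  have hle : rQ A ≤ (A - ν • (1 : Matrix N N ℂ)).rank := Nat.sInf_le ⟨ν, rfl⟩
  exact hle.trans (hν.trans hμ.le)

/-- two corresponding Jordan normal forms have the same `d` and `r`:
if `B` is diagonalizable and the multiset of multiplicities of its distinct eigenvalues
equals the multiset of positive rank differences `rank (A-λI)^(k-1) - rank (A-λI)^k`,
then the centralizers of `A` and `B` have the same dimension and
`min_μ rank (A-μI) = min_μ rank (B-μI)`. -/
theorem stmt13 (n : ℕ) (hn : 1 ≤ n)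
    (A B : Matrix (Fin n) (Fin n) ℂ)
    (P : (Matrix (Fin n) (Fin n) ℂ)ˣ) (D : Fin n → ℂ)
    (hB : B = (P : Matrix (Fin n) (Fin n) ℂ) * Matrix.diagonal D
      * (↑P⁻¹ : Matrix (Fin n) (Fin n) ℂ))
    (hmult :
      (Finset.univ.image D).val.map
          (fun μ => (Finset.univ.filter fun i => D i = μ).card) =
        (((A.charpoly.roots.toFinset ×ˢ Finset.Icc 1 n).filter
            (fun q : ℂ × ℕ =>
              0 < ((A - q.1 • (1 : Matrix (Fin n) (Fin n) ℂ)) ^ (q.2 - 1)).rank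
                - ((A - q.1 • (1 : Matrix (Fin n) (Fin n) ℂ)) ^ q.2).rank)).val.map
          (fun q : ℂ × ℕ =>
            ((A - q.1 • (1 : Matrix (Fin n) (Fin n) ℂ)) ^ (q.2 - 1)).rank
              - ((A - q.1 • (1 : Matrix (Fin n) (Fin n) ℂ)) ^ q.2).rank))) :
    Module.finrank ℂ (commSubmodule (Fin n) A) = Module.finrank ℂ (commSubmodule (Fin n) B) ∧
      rQ A = rQ B := by
  have hrank := rank_conj_diagonal_sub_smul_one P D
  rw [← hB] at hrank
  refine ⟨?_, le_antisymm (rQ_le_of_forall_exists fun μ => ?_)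
    (rQ_le_of_forall_exists fun μ => ?_)⟩
  · have hsum := congrArg (fun s => (s.map (· ^ 2)).sum) hmult
    simp only [Multiset.map_map, Function.comp_def] at hsum
    rw [hB, finrank_commSubmodule_conj, finrank_commSubmodule_diagonal,
      finrank_commSubmodule_eq_sum_sq, Fintype.card_fin]
    refine Eq.trans ?_ hsum.symm
    refine (Finset.sum_filter_of_ne fun q _ hq => ?_).symm
    exact Nat.pos_of_ne_zero fun h0 => hq (by rw [h0]; rfl)
  · rcases Nat.eq_zero_or_pos #{i | D i = μ} with h0 | hpos
    · refine ⟨μ, (Matrix.rank_le_card_height _).trans ?_⟩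
      rw [← hrank μ, h0, add_zero]
    · obtain ⟨i, hi⟩ := Finset.card_pos.1 hpos
      have hmem : #{i | D i = μ} ∈ (Finset.univ.image D).val.map fun μ => #{i | D i = μ} :=
        Multiset.mem_map_of_mem (fun μ => #{i | D i = μ})
          (Finset.mem_image.2 ⟨i, Finset.mem_univ i, (Finset.mem_filter.1 hi).2⟩)
      rw [hmult, Multiset.mem_map] at hmem
      obtain ⟨q, hq, hq'⟩ := hmem
      rw [Finset.mem_val, Finset.mem_filter, Finset.mem_product, Finset.mem_Icc] at hq
      obtain ⟨ι, _, ev, e, h, -⟩ := exists_jordan_block_sizes A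
      rw [rank_pow_pred_sub_rank_pow h q.1 hq.1.2.1] at hq'
      have h1 := rank_pow_pred_sub_rank_pow h q.1 le_rfl
      rw [Nat.sub_self, pow_zero, pow_one, Matrix.rank_one] at h1
      have hle : #{i | ev i = q.1 ∧ q.2 ≤ e i} ≤ #{i | ev i = q.1 ∧ 1 ≤ e i} :=
        Finset.card_le_card (Finset.monotone_filter_right _ fun i _ hi =>
          ⟨hi.1, hq.1.2.1.trans hi.2⟩)
      refine ⟨q.1, ?_⟩
      have := hrank μ
      omega
  · by_cases hlt : (A - μ • (1 : Matrix (Fin n) (Fin n) ℂ)).rank < Fintype.card (Fin n)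
    · have hd : ((A - μ • (1 : Matrix (Fin n) (Fin n) ℂ)) ^ (1 - 1)).rank -
          ((A - μ • (1 : Matrix (Fin n) (Fin n) ℂ)) ^ 1).rank =
          Fintype.card (Fin n) - (A - μ • (1 : Matrix (Fin n) (Fin n) ℂ)).rank := by
        rw [Nat.sub_self, pow_zero, pow_one, Matrix.rank_one]
      have hq : (μ, 1) ∈ (A.charpoly.roots.toFinset ×ˢ Finset.Icc 1 n).filter
            (fun q : ℂ × ℕ =>
              0 < ((A - q.1 • (1 : Matrix (Fin n) (Fin n) ℂ)) ^ (q.2 - 1)).rank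
                - ((A - q.1 • (1 : Matrix (Fin n) (Fin n) ℂ)) ^ q.2).rank) :=
        Finset.mem_filter.2 ⟨Finset.mk_mem_product (mem_roots_charpoly_of_rank_lt hlt)
          (Finset.mem_Icc.2 ⟨le_rfl, hn⟩), hd.symm ▸ Nat.sub_pos_of_lt hlt⟩
      have hmem := Multiset.mem_map_of_mem (fun q : ℂ × ℕ =>
            ((A - q.1 • (1 : Matrix (Fin n) (Fin n) ℂ)) ^ (q.2 - 1)).rank
              - ((A - q.1 • (1 : Matrix (Fin n) (Fin n) ℂ)) ^ q.2).rank)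
        (Finset.mem_def.1 hq)
      rw [← hmult, Multiset.mem_map] at hmem
      obtain ⟨ν, -, hν⟩ := hmem
      rw [hd] at hν
      have := hrank ν
      exact ⟨ν, by omega⟩
    · exact ⟨μ, (Matrix.rank_le_card_height _).trans (not_lt.1 hlt)⟩
end
end

section
/- With the above setup, set R := {(A₁¹X₁ − X₁A₁², …, A_{p+1}¹X_{p+1} − X_{p+1}A_{p+1}²) : X_j ∈ M_{m₁×m₂}(ℂ), Σ_{j=1}^{p+1}(A_j¹X_j − X_jA_j²) = 0} and Q := {(A₁¹X − XA₁², …, A_{p+1}¹X − XA_{p+1}²) : X ∈ M_{m₁×m₂}(ℂ)}, both complex vector subspaces of (M_{m₁×m₂}(ℂ))^{p+1}, and ξ := dim_ℂ R − dim_ℂ Q (= dim Ext¹(P₁,P₂)). Then ξ = (Σ_{j=1}^{p+1} (d_j′ − d_j¹ − d_j²)/2) − 2m₁m₂. -/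
open Matrix Polynomial BigOperators Finset

noncomputable section

/-- For square matrices `A`, `B`, the linear map `X ↦ A * X - X * B` on rectangular
matrices. -/
def commMap {m₁ m₂ : ℕ} (A : Matrix (Fin m₁) (Fin m₁) ℂ) (B : Matrix (Fin m₂) (Fin m₂) ℂ) :
    Matrix (Fin m₁) (Fin m₂) ℂ →ₗ[ℂ] Matrix (Fin m₁) (Fin m₂) ℂ where
  toFun X := A * X - X * B
  map_add' X Y := by
    show A * (X + Y) - (X + Y) * B = (A * X - X * B) + (A * Y - Y * B)
    rw [Matrix.mul_add, Matrix.add_mul]; abel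
  map_smul' c X := by
    show A * (c • X) - (c • X) * B = c • (A * X - X * B)
    rw [Matrix.mul_smul, Matrix.smul_mul, smul_sub]

/-- Summation of the components, as a linear map. -/
def sumMap (q : ℕ) (M : Type*) [AddCommGroup M] [Module ℂ M] :
    (Fin q → M) →ₗ[ℂ] M :=
  ∑ j : Fin q, LinearMap.proj j

/-- The map `(X_j)_j ↦ (A¹_j X_j - X_j A²_j)_j`. -/
def psiMap {q m₁ m₂ : ℕ} (A1 : Fin q → Matrix (Fin m₁) (Fin m₁) ℂ)
    (A2 : Fin q → Matrix (Fin m₂) (Fin m₂) ℂ) :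
    (Fin q → Matrix (Fin m₁) (Fin m₂) ℂ) →ₗ[ℂ] (Fin q → Matrix (Fin m₁) (Fin m₂) ℂ) :=
  LinearMap.pi (fun j => commMap (A1 j) (A2 j) ∘ₗ LinearMap.proj j)

/-- The space `R = {(A¹_j X_j - X_j A²_j)_j : Σ_j (A¹_j X_j - X_j A²_j) = 0}`. -/
def Rsub {q m₁ m₂ : ℕ} (A1 : Fin q → Matrix (Fin m₁) (Fin m₁) ℂ)
    (A2 : Fin q → Matrix (Fin m₂) (Fin m₂) ℂ) :
    Submodule ℂ (Fin q → Matrix (Fin m₁) (Fin m₂) ℂ) :=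
  Submodule.map (psiMap A1 A2)
    (LinearMap.ker ((sumMap q (Matrix (Fin m₁) (Fin m₂) ℂ)) ∘ₗ psiMap A1 A2))

/-- The space `Q = {(A¹_j X - X A²_j)_j : X}`. -/
def Qsub {q m₁ m₂ : ℕ} (A1 : Fin q → Matrix (Fin m₁) (Fin m₁) ℂ)
    (A2 : Fin q → Matrix (Fin m₂) (Fin m₂) ℂ) :
    Submodule ℂ (Fin q → Matrix (Fin m₁) (Fin m₂) ℂ) :=
  LinearMap.range (LinearMap.pi (fun j => commMap (A1 j) (A2 j)))

/-- `commMap B A` and `-commMap A B` are adjoint with respect to the trace pairing. -/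
lemma trace_mul_commMap {m n : ℕ} (A : Matrix (Fin m) (Fin m) ℂ) (B : Matrix (Fin n) (Fin n) ℂ)
    (Y : Matrix (Fin n) (Fin m) ℂ) (X : Matrix (Fin m) (Fin n) ℂ) :
    (Y * commMap A B X).trace = -(commMap B A Y * X).trace := by
  change (Y * (A * X - X * B)).trace = -((B * Y - Y * A) * X).trace
  rw [Matrix.mul_sub, Matrix.sub_mul, Matrix.trace_sub, Matrix.trace_sub, ← Matrix.mul_assoc Y X B,
    Matrix.trace_mul_comm (Y * X) B, Matrix.mul_assoc B Y X, Matrix.mul_assoc Y A X]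
  ring

/-- The trace pairing between `n × m` and `m × n` matrices. -/
def tracePairing (m n : ℕ) :
    Matrix (Fin n) (Fin m) ℂ →ₗ[ℂ] Module.Dual ℂ (Matrix (Fin m) (Fin n) ℂ) :=
  LinearMap.mk₂ ℂ (fun Y X => (Y * X).trace)
    (fun Y Y' X => by rw [Matrix.add_mul, Matrix.trace_add])
    (fun c Y X => by rw [Matrix.smul_mul, Matrix.trace_smul])
    (fun Y X X' => by rw [Matrix.mul_add, Matrix.trace_add])
    (fun c Y X => by rw [Matrix.mul_smul, Matrix.trace_smul])

lemma tracePairing_injective (m n : ℕ) : Function.Injective (tracePairing m n) := by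
  rw [injective_iff_map_eq_zero]
  intro Y hY
  ext i j
  have h : (Y * Matrix.single j i (1 : ℂ)).trace = 0 := LinearMap.congr_fun hY _
  rwa [Matrix.trace_mul_comm, Matrix.trace_single_mul, one_smul] at h

lemma finrank_range_commMap_le {m n : ℕ} (A : Matrix (Fin m) (Fin m) ℂ)
    (B : Matrix (Fin n) (Fin n) ℂ) :
    Module.finrank ℂ (LinearMap.range (commMap B A)) ≤
      Module.finrank ℂ (LinearMap.range (commMap A B)) := by
  have hcomp : tracePairing m n ∘ₗ commMap B A =
      (-(commMap A B).dualMap) ∘ₗ tracePairing m n := by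
    ext1 Y
    apply LinearMap.ext
    intro X
    change (commMap B A Y * X).trace = -(Y * commMap A B X).trace
    rw [trace_mul_commMap, neg_neg]
  calc Module.finrank ℂ (LinearMap.range (commMap B A))
      = Module.finrank ℂ ((LinearMap.range (commMap B A)).map (tracePairing m n)) :=
        (Submodule.equivMapOfInjective _ (tracePairing_injective m n) _).finrank_eq
    _ = Module.finrank ℂ (LinearMap.range ((-(commMap A B).dualMap) ∘ₗ tracePairing m n)) := by
        rw [← LinearMap.range_comp, hcomp]
    _ ≤ Module.finrank ℂ (LinearMap.range (-(commMap A B).dualMap)) :=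
        Submodule.finrank_mono (LinearMap.range_comp_le_range _ _)
    _ = Module.finrank ℂ (LinearMap.range (commMap A B)) := by
        rw [LinearMap.range_neg, LinearMap.finrank_range_dualMap_eq_finrank_range]

lemma finrank_range_commMap_comm {m n : ℕ} (A : Matrix (Fin m) (Fin m) ℂ)
    (B : Matrix (Fin n) (Fin n) ℂ) :
    Module.finrank ℂ (LinearMap.range (commMap B A)) =
      Module.finrank ℂ (LinearMap.range (commMap A B)) :=
  le_antisymm (finrank_range_commMap_le A B) (finrank_range_commMap_le B A)

lemma mem_ker_commMap {m n : ℕ} {A : Matrix (Fin m) (Fin m) ℂ} {B : Matrix (Fin n) (Fin n) ℂ}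
    {X : Matrix (Fin m) (Fin n) ℂ} : X ∈ LinearMap.ker (commMap A B) ↔ A * X = X * B :=
  LinearMap.mem_ker.trans sub_eq_zero

lemma fromBlocks_mem_commSubmodule {m n : ℕ} {A : Matrix (Fin m) (Fin m) ℂ}
    {B : Matrix (Fin n) (Fin n) ℂ} {P : Matrix (Fin m) (Fin m) ℂ} {Q : Matrix (Fin m) (Fin n) ℂ}
    {R : Matrix (Fin n) (Fin m) ℂ} {S : Matrix (Fin n) (Fin n) ℂ} :
    fromBlocks P Q R S ∈ commSubmodule (Fin m ⊕ Fin n) (fromBlocks A 0 0 B) ↔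
      P ∈ commSubmodule (Fin m) A ∧ Q ∈ LinearMap.ker (commMap A B) ∧
        R ∈ LinearMap.ker (commMap B A) ∧ S ∈ commSubmodule (Fin n) B := by
  rw [mem_ker_commMap, mem_ker_commMap]
  change fromBlocks P Q R S * fromBlocks A 0 0 B = fromBlocks A 0 0 B * fromBlocks P Q R S ↔
    P * A = A * P ∧ _ ∧ _ ∧ S * B = B * S
  rw [fromBlocks_multiply, fromBlocks_multiply, fromBlocks_inj]
  simp [eq_comm]

/-- The centralizer of a block diagonal matrix splits into its four blocks. -/
def commSubmoduleFromBlocksEquiv {m n : ℕ} (A : Matrix (Fin m) (Fin m) ℂ)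
    (B : Matrix (Fin n) (Fin n) ℂ) :
    commSubmodule (Fin m ⊕ Fin n) (fromBlocks A 0 0 B) ≃ₗ[ℂ]
      (commSubmodule (Fin m) A × LinearMap.ker (commMap A B)) ×
        (LinearMap.ker (commMap B A) × commSubmodule (Fin n) B) where
  toFun X :=
    have h := fromBlocks_mem_commSubmodule.1 ((fromBlocks_toBlocks X.1).symm ▸ X.2)
    ((⟨X.1.toBlocks₁₁, h.1⟩, ⟨X.1.toBlocks₁₂, h.2.1⟩),
      (⟨X.1.toBlocks₂₁, h.2.2.1⟩, ⟨X.1.toBlocks₂₂, h.2.2.2⟩))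
  map_add' _ _ := rfl
  map_smul' _ _ := rfl
  invFun Y := ⟨fromBlocks Y.1.1.1 Y.1.2.1 Y.2.1.1 Y.2.2.1,
    fromBlocks_mem_commSubmodule.2 ⟨Y.1.1.2, Y.1.2.2, Y.2.1.2, Y.2.2.2⟩⟩
  left_inv X := Subtype.ext (fromBlocks_toBlocks X.1)
  right_inv _ := rfl

lemma dQ_cast {N : Type*} [Fintype N] (A : Matrix N N ℂ) :
    (dQ A : ℤ) = (Fintype.card N : ℤ) ^ 2 - Module.finrank ℂ (commSubmodule N A) := by
  classical
  have h : Module.finrank ℂ (commSubmodule N A) ≤ Fintype.card N ^ 2 := by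
    refine (Submodule.finrank_le _).trans ?_
    simp [Module.finrank_matrix, sq]
  rw [dQ, Nat.cast_sub h, Nat.cast_pow]

lemma dQ_fromBlocks_sub {m n : ℕ} (A : Matrix (Fin m) (Fin m) ℂ) (B : Matrix (Fin n) (Fin n) ℂ) :
    (dQ (fromBlocks A 0 0 B) : ℤ) - dQ A - dQ B =
      2 * Module.finrank ℂ (LinearMap.range (commMap A B)) := by
  have hAB := LinearMap.finrank_range_add_finrank_ker (commMap A B)
  have hBA := LinearMap.finrank_range_add_finrank_ker (commMap B A)
  have hdim := (commSubmoduleFromBlocksEquiv A B).finrank_eq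
  rw [finrank_range_commMap_comm A B] at hBA
  simp only [Module.finrank_prod, Module.finrank_matrix, Fintype.card_fin, Module.finrank_self,
    mul_one] at hAB hBA hdim
  rw [dQ_cast, dQ_cast, dQ_cast, hdim]
  simp only [Fintype.card_sum, Fintype.card_fin]
  zify at hAB hBA
  push_cast
  linarith [mul_comm (m : ℤ) n, add_sq (m : ℤ) n]

lemma aeval_mul_eq_mul_aeval {m n : ℕ} {A : Matrix (Fin m) (Fin m) ℂ}
    {B : Matrix (Fin n) (Fin n) ℂ} {X : Matrix (Fin m) (Fin n) ℂ} (h : A * X = X * B)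
    (f : ℂ[X]) : aeval A f * X = X * aeval B f := by
  induction f using Polynomial.induction_on' with
  | add f g hf hg => rw [map_add, map_add, Matrix.add_mul, Matrix.mul_add, hf, hg]
  | monomial k c =>
    have hk : A ^ k * X = X * B ^ k := by
      induction k with
      | zero => simp
      | succ k ih => rw [pow_succ, pow_succ', Matrix.mul_assoc, h, ← Matrix.mul_assoc, ih,
          Matrix.mul_assoc, ← pow_succ, ← pow_succ']
    rw [aeval_monomial, aeval_monomial, ← Algebra.smul_def, ← Algebra.smul_def, Matrix.smul_mul,
      Matrix.mul_smul, hk]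

lemma commMap_injective_of_isCoprime_charpoly {m n : ℕ} {A : Matrix (Fin m) (Fin m) ℂ}
    {B : Matrix (Fin n) (Fin n) ℂ} (h : IsCoprime A.charpoly B.charpoly) :
    Function.Injective (commMap A B) := by
  rw [injective_iff_map_eq_zero]
  intro X hX
  obtain ⟨u, v, huv⟩ := h
  have hv : aeval A v * aeval A B.charpoly = 1 := by
    have := congrArg (aeval A) huv
    rwa [map_add, map_mul, map_mul, Matrix.aeval_self_charpoly, mul_zero, zero_add, map_one] at this
  have hX' : aeval A B.charpoly * X = 0 := by
    rw [aeval_mul_eq_mul_aeval (mem_ker_commMap.1 hX), Matrix.aeval_self_charpoly, Matrix.mul_zero]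
  rw [← Matrix.one_mul X, ← hv, Matrix.mul_assoc, hX', Matrix.mul_zero]

lemma isCoprime_prod_X_sub_C {K ι κ : Type*} [Field K] [Fintype ι] [Fintype κ] {a : ι → K}
    {b : κ → K} (h : ∀ i k, a i ≠ b k) : IsCoprime (∏ i, (X - C (a i))) (∏ k, (X - C (b k))) :=
  IsCoprime.prod_left fun i _ => IsCoprime.prod_right fun k _ =>
    isCoprime_X_sub_C_of_isUnit_sub (sub_ne_zero.2 (h i k)).isUnit

lemma finrank_range_psiMap {q m n : ℕ} (A : Fin q → Matrix (Fin m) (Fin m) ℂ)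
    (B : Fin q → Matrix (Fin n) (Fin n) ℂ) :
    Module.finrank ℂ (LinearMap.range (psiMap A B)) =
      ∑ j, Module.finrank ℂ (LinearMap.range (commMap (A j) (B j))) := by
  have h : LinearMap.range (psiMap A B) =
      Submodule.pi Set.univ fun j => LinearMap.range (commMap (A j) (B j)) := by
    ext Y
    simp only [LinearMap.mem_range, Submodule.mem_pi, Set.mem_univ, true_imp_iff]
    constructor
    · rintro ⟨X, rfl⟩ j
      exact ⟨X j, rfl⟩
    · intro hY
      choose X hX using hY
      exact ⟨X, funext hX⟩
  let e : (Submodule.pi Set.univ fun j => LinearMap.range (commMap (A j) (B j))) ≃ₗ[ℂ]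
      (∀ j, LinearMap.range (commMap (A j) (B j))) :=
    { toFun := fun Y j => ⟨Y.1 j, Y.2 j trivial⟩
      map_add' := fun _ _ => rfl
      map_smul' := fun _ _ => rfl
      invFun := fun Y => ⟨fun j => (Y j).1, fun j _ => (Y j).2⟩
      left_inv := fun _ => rfl
      right_inv := fun _ => rfl }
  rw [h, e.finrank_eq, Module.finrank_pi_fintype]

lemma sumMap_apply {q : ℕ} {M : Type*} [AddCommGroup M] [Module ℂ M] (x : Fin q → M) :
    sumMap q M x = ∑ j, x j := by
  simp [sumMap]

/-- If one of the maps `commMap (A j) (B j)` is onto, then `dim R + m n` is the sum of the ranks of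
all of them. -/
lemma finrank_Rsub_add {q m n : ℕ} (A : Fin q → Matrix (Fin m) (Fin m) ℂ)
    (B : Fin q → Matrix (Fin n) (Fin n) ℂ) {k : Fin q}
    (hk : Function.Surjective (commMap (A k) (B k))) :
    Module.finrank ℂ (Rsub A B) + m * n =
      ∑ j, Module.finrank ℂ (LinearMap.range (commMap (A j) (B j))) := by
  rw [← finrank_range_psiMap]
  let s := (sumMap q (Matrix (Fin m) (Fin n) ℂ)).domRestrict (LinearMap.range (psiMap A B))
  have hs : LinearMap.range s = ⊤ := by
    refine LinearMap.range_eq_top.2 fun Y => ?_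
    obtain ⟨X, hX⟩ := hk Y
    refine ⟨⟨psiMap A B (Pi.single k X), LinearMap.mem_range_self _ _⟩, ?_⟩
    change sumMap q _ (psiMap A B (Pi.single k X)) = Y
    rw [sumMap_apply, Finset.sum_eq_single k, ← hX]
    · change commMap (A k) (B k) (Pi.single (M := fun _ => Matrix (Fin m) (Fin n) ℂ) k X k) = _
      rw [Pi.single_eq_same]
    · intro j _ hj
      change commMap (A j) (B j) (Pi.single (M := fun _ => Matrix (Fin m) (Fin n) ℂ) k X j) = 0
      rw [Pi.single_eq_of_ne hj, map_zero]
    · simp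
  have hR : Rsub A B = (LinearMap.ker s).map (LinearMap.range (psiMap A B)).subtype := by
    ext Y
    constructor
    · rintro ⟨X, hX, rfl⟩
      exact ⟨⟨psiMap A B X, LinearMap.mem_range_self _ _⟩, hX, rfl⟩
    · rintro ⟨⟨_, X, rfl⟩, hX, rfl⟩
      exact ⟨X, hX, rfl⟩
  have hrank := LinearMap.finrank_range_add_finrank_ker s
  rw [hs, finrank_top, Module.finrank_matrix, Module.finrank_self, Fintype.card_fin,
    Fintype.card_fin, mul_one] at hrank
  rw [hR, Submodule.finrank_map_subtype_eq, add_comm, hrank]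

lemma finrank_Qsub {q m n : ℕ} (A : Fin q → Matrix (Fin m) (Fin m) ℂ)
    (B : Fin q → Matrix (Fin n) (Fin n) ℂ) {k : Fin q}
    (hk : Function.Injective (commMap (A k) (B k))) : Module.finrank ℂ (Qsub A B) = m * n := by
  rw [Qsub, LinearMap.finrank_range_of_inj]
  · simp [Module.finrank_matrix]
  · exact fun X Y h => hk (congrFun h k)

/-- `ξ = dim Ext¹(P₁,P₂) = (Σ_j (d_j' - d_j¹ - d_j²)/2) - 2 m₁ m₂`. -/
theorem stmt16 (p m₁ m₂ : ℕ) (hp : 2 ≤ p) (h₁ : 1 ≤ m₁) (h₂ : 1 ≤ m₂)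
    (A1 : Fin (p + 1) → Matrix (Fin m₁) (Fin m₁) ℂ)
    (A2 : Fin (p + 1) → Matrix (Fin m₂) (Fin m₂) ℂ)
    (hsum1 : ∑ j, A1 j = 0) (hsum2 : ∑ j, A2 j = 0)
    (htc1 : TrivCent A1) (htc2 : TrivCent A2)
    (ev1 : Fin m₁ → ℂ) (ev2 : Fin m₂ → ℂ)
    (hev1 : Function.Injective ev1 ∧
      (A1 (Fin.last p)).charpoly = ∏ i, (Polynomial.X - Polynomial.C (ev1 i)))
    (hev2 : Function.Injective ev2 ∧
      (A2 (Fin.last p)).charpoly = ∏ i, (Polynomial.X - Polynomial.C (ev2 i)))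
    (hdisj : ∀ i i', ev1 i ≠ ev2 i')
 :
    (Module.finrank ℂ (Rsub A1 A2) : ℤ) - (Module.finrank ℂ (Qsub A1 A2) : ℤ) =
      (∑ j : Fin (p + 1),
        ((dQ (Matrix.fromBlocks (A1 j) 0 0 (A2 j)) : ℤ) - (dQ (A1 j) : ℤ)
          - (dQ (A2 j) : ℤ)) / 2) - 2 * m₁ * m₂ := by
  have hinj : Function.Injective (commMap (A1 (Fin.last p)) (A2 (Fin.last p))) := by
    apply commMap_injective_of_isCoprime_charpoly
    rw [hev1.2, hev2.2]
    exact isCoprime_prod_X_sub_C hdisj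
  have hR := finrank_Rsub_add A1 A2 (LinearMap.injective_iff_surjective.1 hinj)
  have hhalf : ∀ j, ((dQ (Matrix.fromBlocks (A1 j) 0 0 (A2 j)) : ℤ) - (dQ (A1 j) : ℤ)
      - (dQ (A2 j) : ℤ)) / 2 = Module.finrank ℂ (LinearMap.range (commMap (A1 j) (A2 j))) :=
    fun j => by rw [dQ_fromBlocks_sub, Int.mul_ediv_cancel_left _ two_ne_zero]
  rw [Finset.sum_congr rfl fun j _ => hhalf j, finrank_Qsub A1 A2 hinj, ← Nat.cast_sum, ← hR]
  push_cast
  ring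
end
end
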